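/- Let F : ℝ^d → ℝ be L-smooth, let Δ > 0, η = 1/L, and let w̃ ∈ ℝ^d satisfy ‖∇F(w̃)‖ ≤ 4Δ. Let w_0 ∈ B(w̃, r) and let w_0, w_1, …, w_t be a Δ-inexact gradient descent sequence for F with step size η, where t ≤ T_th and ‖w_t − w_0‖ ≥ R. Then F(w̃) − F(w_t) ≥ (L/(4·T_th))·R² − Δ²·T_th/L − 4Δ·r − (L/2)·r². -/

import Mathlib

theorem descent_aux {d : ℕ} (F : EuclideanSpace ℝ (Fin d) → ℝ) (L : ℝ)
    (hdiff : Differentiable ℝ F)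
    (hsmooth : ∀ x y : EuclideanSpace ℝ (Fin d),
      ‖gradient F x - gradient F y‖ ≤ L * ‖x - y‖)
    (x s : EuclideanSpace ℝ (Fin d)) :
    F (x + s) ≤ F x + inner ℝ (gradient F x) s + L / 2 * ‖s‖ ^ 2 := by
  have hline : ∀ u : ℝ, HasDerivAt (fun u : ℝ => F (x + u • s))
      (inner ℝ (gradient F (x + u • s)) s) u := by
    intro u
    have h1 : HasDerivAt (fun u : ℝ => x + u • s) s u := by
      simpa using ((hasDerivAt_id u).smul_const s).const_add x
    have h2 := (hdiff (x + u • s)).hasGradientAt.hasFDerivAt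
    have h3 := h2.comp_hasDerivAt u h1
    exact h3.congr_deriv (by simp)
  have hB : ∀ u : ℝ, HasDerivAt
      (fun u : ℝ => F x + u * inner ℝ (gradient F x) s + L / 2 * ‖s‖ ^ 2 * u ^ 2)
      (inner ℝ (gradient F x) s + L * ‖s‖ ^ 2 * u) u := by
    intro u
    have h1 := ((hasDerivAt_id u).mul_const (inner ℝ (gradient F x) s)).const_add (F x)
    have h2 := (hasDerivAt_pow 2 u).const_mul (L / 2 * ‖s‖ ^ 2)
    refine (h1.add h2).congr_deriv ?_
    simp
    ring
  have key := image_le_of_deriv_right_le_deriv_boundary (a := 0) (b := 1)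
    (fun u _ => (hline u).continuousAt.continuousWithinAt)
    (fun u _ => (hline u).hasDerivWithinAt)
    (by simp)
    (fun u _ => (hB u).continuousAt.continuousWithinAt)
    (fun u _ => (hB u).hasDerivWithinAt)
    (by
      intro u hu
      have h1 := real_inner_le_norm (gradient F (x + u • s) - gradient F x) s
      have h2 := hsmooth (x + u • s) x
      rw [add_sub_cancel_left, norm_smul, Real.norm_of_nonneg hu.1] at h2
      have h3 := mul_le_mul_of_nonneg_right h2 (norm_nonneg s)
      rw [inner_sub_left] at h1
      nlinarith) (x := 1) (by simp)
  simpa using key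

/-- (Function decrease upon escaping.) If `‖∇F(w̃)‖ ≤ 4Δ`, a `Δ`-inexact
gradient descent sequence with step `1/L` started at `w₀ ∈ B(w̃, r)` that moves distance at
least `R` within `t ≤ T_th` steps decreases `F` from `w̃` by at least
`(L/(4T_th))R² − Δ²T_th/L − 4Δr − (L/2)r²`. -/
theorem escape_function_decrease
    (d : ℕ) (F : EuclideanSpace ℝ (Fin d) → ℝ) (L Δ R r : ℝ)
    (hL : 0 < L) (hΔ : 0 < Δ) (hR : 0 < R) (hr : 0 < r)
    (hdiff : Differentiable ℝ F)
    (hsmooth : ∀ x y : EuclideanSpace ℝ (Fin d),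
      ‖gradient F x - gradient F y‖ ≤ L * ‖x - y‖)
    (wt : EuclideanSpace ℝ (Fin d)) (hwt : ‖gradient F wt‖ ≤ 4 * Δ)
    (Tth : ℕ) (hTth : 0 < Tth)
    (t : ℕ) (ht : t ≤ Tth)
    (w g : ℕ → EuclideanSpace ℝ (Fin d))
    (hw0 : w 0 ∈ Metric.closedBall wt r)
    (hseq : ∀ τ < t, ‖g τ - gradient F (w τ)‖ ≤ Δ ∧
      w (τ + 1) = w τ - (1 / L) • g τ)
    (hesc : ‖w t - w 0‖ ≥ R) :
    F wt - F (w t) ≥ L / (4 * Tth) * R ^ 2 - Δ ^ 2 * Tth / L - 4 * Δ * r - L / 2 * r ^ 2 := by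
  have hstep : ∀ k ≤ t, L / 4 * ∑ i ∈ Finset.range k, ‖w (i + 1) - w i‖ ^ 2
      ≤ F (w 0) - F (w k) + k * (Δ ^ 2 / L) := by
    intro k
    induction k with
    | zero => simp
    | succ k ih =>
      intro hk
      have ih := ih (by omega)
      obtain ⟨he, hw⟩ := hseq k (by omega)
      have hd := descent_aux F L hdiff hsmooth (w k) (w (k + 1) - w k)
      rw [add_sub_cancel] at hd
      have hg : g k = -(L • (w (k + 1) - w k)) := by
        rw [hw, sub_sub_cancel_left, smul_neg, neg_neg, smul_smul, mul_one_div_cancel hL.ne',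
          one_smul]
      set s := w (k + 1) - w k with hs
      have hi := real_inner_le_norm (-(g k - gradient F (w k))) s
      rw [norm_neg, neg_sub, inner_sub_left, hg, inner_neg_left, real_inner_smul_left,
        real_inner_self_eq_norm_sq, ← hg] at hi
      have h3 := mul_le_mul_of_nonneg_right he (norm_nonneg s)
      have h4 : Δ * ‖s‖ ≤ L / 4 * ‖s‖ ^ 2 + Δ ^ 2 / L := by
        have : L / 4 * ‖s‖ ^ 2 + Δ ^ 2 / L - Δ * ‖s‖ = (L * ‖s‖ / 2 - Δ) ^ 2 / L := by
          field_simp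
          ring
        have : 0 ≤ (L * ‖s‖ / 2 - Δ) ^ 2 / L := by positivity
        linarith
      rw [Finset.sum_range_succ, ← hs]
      push_cast
      linarith
  have hS := hstep t le_rfl
  have hn : R ^ 2 ≤ t * ∑ i ∈ Finset.range t, ‖w (i + 1) - w i‖ ^ 2 := by
    have h1 : R ≤ ∑ i ∈ Finset.range t, ‖w (i + 1) - w i‖ := by
      refine hesc.le.trans ?_
      rw [← Finset.sum_range_sub]
      exact norm_sum_le _ _
    have h2 := sq_sum_le_card_mul_sum_sq (s := Finset.range t)
      (f := fun i => ‖w (i + 1) - w i‖)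
    rw [Finset.card_range] at h2
    exact (pow_le_pow_left₀ hR.le h1 2).trans h2
  have hT : (0 : ℝ) < Tth := by exact_mod_cast hTth
  have htT : (t : ℝ) ≤ Tth := by exact_mod_cast ht
  set S := ∑ i ∈ Finset.range t, ‖w (i + 1) - w i‖ ^ 2
  have hS0 : 0 ≤ S := Finset.sum_nonneg fun i _ => by positivity
  have h5 : L / (4 * Tth) * R ^ 2 ≤ L / 4 * S := by
    have : R ^ 2 ≤ Tth * S := hn.trans (mul_le_mul_of_nonneg_right htT hS0)
    calc L / (4 * Tth) * R ^ 2 ≤ L / (4 * Tth) * (Tth * S) := by gcongr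
      _ = L / 4 * S := by field_simp
  have h6 : (t : ℝ) * (Δ ^ 2 / L) ≤ Δ ^ 2 * Tth / L := by
    have : (t : ℝ) * (Δ ^ 2 / L) ≤ Tth * (Δ ^ 2 / L) := by gcongr
    calc _ ≤ _ := this
      _ = _ := by ring
  have h7 : F (w 0) ≤ F wt + 4 * Δ * r + L / 2 * r ^ 2 := by
    have hd := descent_aux F L hdiff hsmooth wt (w 0 - wt)
    rw [add_sub_cancel] at hd
    have hr0 : ‖w 0 - wt‖ ≤ r := by simpa [dist_eq_norm] using hw0
    have hi := real_inner_le_norm (gradient F wt) (w 0 - wt)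
    have h1 : ‖gradient F wt‖ * ‖w 0 - wt‖ ≤ 4 * Δ * r := by gcongr
    have h2 : L / 2 * ‖w 0 - wt‖ ^ 2 ≤ L / 2 * r ^ 2 := by gcongr
    linarith
  linarith
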